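/- Fix a commutative semiring R and a list α = [I₁, …, Iₘ] of finite linear orders, and define nested stream types by 𝒮_[] = R and 𝒮_(i::β) = indexed streams of type I_i → 𝒮_β, with evaluation eval_[] = id : R → R and, recursively, eval_(i::β)(q) : I_i → (I_{β} → R) equal to the sum over reachable ready states r of q of the function supported at ι(r) with value eval_β(v(r)); define multiplication on 𝒮_[] = R to be the semiring multiplication and on 𝒮_(i::β) to be the product stream construction using the (recursively defined) multiplication of values in 𝒮_β. Then for all hereditarily simple and strict nested streams a, b ∈ 𝒮_α, eval_α(a·b) = eval_α(a) · eval_α(b), where the right-hand multiplication is pointwise multiplication of the resulting curried functions I₁ → ⋯ → Iₘ → R. -/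

import Mathlib

/-- An indexed stream of type `I → V`: a state space `σ`, a current state `q`,
an index function `ι`, a value function `v`, a ready flag, and a successor `δ`. -/
structure IStream (σ : Type*) (I : Type*) (V : Type*) where
  q : σ
  ι : σ → I
  v : σ → V
  ready : σ → Bool
  δ : σ → σ

namespace IStream

variable {σ σ₁ σ₂ : Type*} {I : Type*} {V : Type*}

/-- The set of states reachable from the current state. -/
def reachSet (s : IStream σ I V) : Set σ := {r | ∃ k : ℕ, r = s.δ^[k] s.q}

/-- A stream is finite if a terminal state is reachable from its current state. -/
def Finite (s : IStream σ I V) : Prop := ∃ t ∈ s.reachSet, s.δ t = t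

/-- Finite, with the reachable terminal state not ready. -/
def FiniteNR (s : IStream σ I V) : Prop :=
  ∃ t ∈ s.reachSet, s.δ t = t ∧ s.ready t = false

/-- Monotonic: the index is nondecreasing along every reachable transition. -/
def Monotonic [Preorder I] (s : IStream σ I V) : Prop :=
  ∀ r ∈ s.reachSet, s.ι r ≤ s.ι (s.δ r)

/-- Reduced: distinct reachable ready states (one reachable from the other)
have distinct indices. -/
def Reduced (s : IStream σ I V) : Prop :=
  ∀ r s', r ∈ s.reachSet → (∃ k : ℕ, s' = s.δ^[k] r) →
    s.ready r = true → s.ready s' = true → s.ι r = s.ι s' → r = s'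

/-- A simple stream: finite (with non-ready terminal state), monotonic, reduced. -/
def IsSimple [Preorder I] (s : IStream σ I V) : Prop :=
  s.FiniteNR ∧ s.Monotonic ∧ s.Reduced

/-- The stream restarted at the successor of its current state. -/
def step (s : IStream σ I V) : IStream σ I V := { s with q := s.δ s.q }

open Classical in
/-- Evaluation of a stream: the sum, over reachable states `r`, of the function
supported at `ι r` with value `f (v r)` when `ready r`, and `0` otherwise. -/
noncomputable def eval {R : Type*} [AddCommMonoid R] (s : IStream σ I V) (f : V → R) : I → R :=
  fun y => ∑ᶠ r ∈ s.reachSet,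
    if s.ready r = true then (if y = s.ι r then f (s.v r) else 0) else 0

/-- The product stream. -/
def mul [LinearOrder I] [Mul V] (a : IStream σ₁ I V) (b : IStream σ₂ I V) :
    IStream (σ₁ × σ₂) I V where
  q := (a.q, b.q)
  ι p := max (a.ι p.1) (b.ι p.2)
  v p := a.v p.1 * b.v p.2
  ready p := a.ready p.1 && b.ready p.2 && decide (a.ι p.1 = b.ι p.2)
  δ p := if a.ι p.1 < b.ι p.2 ∨ (a.ι p.1 = b.ι p.2 ∧ a.ready p.1 = false)
         then (a.δ p.1, p.2) else (p.1, b.δ p.2)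

/-- The sum stream. -/
def add [LinearOrder I] [Add V] [Zero V] (a : IStream σ₁ I V) (b : IStream σ₂ I V) :
    IStream (σ₁ × σ₂) I V where
  q := (a.q, b.q)
  ι p := min (a.ι p.1) (b.ι p.2)
  v p := (if a.ι p.1 ≤ b.ι p.2 then a.v p.1 else 0) +
         (if b.ι p.2 ≤ a.ι p.1 then b.v p.2 else 0)
  ready p := a.ready p.1 || b.ready p.2
  δ p := if a.ι p.1 < b.ι p.2 ∨ (a.ι p.1 = b.ι p.2 ∧ a.ready p.1 = false ∧ b.ready p.2 = true)
         then (a.δ p.1, p.2)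
         else if b.ι p.2 < a.ι p.1 ∨ (a.ι p.1 = b.ι p.2 ∧ b.ready p.2 = false ∧ a.ready p.1 = true)
         then (p.1, b.δ p.2)
         else (a.δ p.1, b.δ p.2)

end IStream

/-- A bundled finite linear order (an index set `Iᵢ`). -/
structure IdxTy : Type 1 where
  carrier : Type
  [ord : LinearOrder carrier]
  [fin : Fintype carrier]

attribute [instance] IdxTy.ord IdxTy.fin

/-- A stream of type `I → V` with bundled (hidden) state space. -/
structure BStream (I : Type) (V : Type 1) : Type 1 where
  state : Type
  str : IStream state I V

/-- The type `𝒮_α` of nested streams: `𝒮_[] = R` and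
`𝒮_(i::β)` = indexed streams of type `Iᵢ → 𝒮_β`. -/
def NS (R : Type) : List IdxTy → Type 1
  | [] => ULift.{1} R
  | i :: β => BStream i.carrier (NS R β)

/-- The type of curried functions `I₁ → ⋯ → Iₘ → R`. -/
def NFun (R : Type) : List IdxTy → Type
  | [] => R
  | i :: β => i.carrier → NFun R β

/-- `NFun R α` is a commutative additive monoid (pointwise, recursively). -/
noncomputable def nfunAddCommMonoid (R : Type) [AddCommMonoid R] :
    (α : List IdxTy) → AddCommMonoid (NFun R α)
  | [] => inferInstanceAs (AddCommMonoid R)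
  | _ :: β =>
    letI := nfunAddCommMonoid R β
    inferInstanceAs (AddCommMonoid (_ → NFun R β))

/-- Pointwise multiplication of curried functions `I₁ → ⋯ → Iₘ → R`. -/
def nfunMul (R : Type) [Mul R] : (α : List IdxTy) → NFun R α → NFun R α → NFun R α
  | [], f, g =>
    letI : Mul (NFun R []) := inferInstanceAs (Mul R)
    f * g
  | _ :: β, f, g => fun x => nfunMul R β (f x) (g x)

/-- Evaluation of nested streams: `eval_[] = id` and
`eval_(i::β) q = ⟦q⟧_(eval_β)`. -/
noncomputable def nsEval (R : Type) [AddCommMonoid R] :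
    (α : List IdxTy) → NS R α → NFun R α
  | [], a => (a : ULift.{1} R).down
  | _ :: β, a =>
    letI := nfunAddCommMonoid R β
    (a : BStream _ (NS R β)).str.eval (nsEval R β)

/-- Multiplication of nested streams: semiring multiplication on `𝒮_[] = R`,
and the product-stream construction on `𝒮_(i::β)` using the recursively
defined multiplication of values in `𝒮_β`. -/
def nsMul (R : Type) [CommSemiring R] : (α : List IdxTy) → NS R α → NS R α → NS R α
  | [], a, b => (ULift.up ((a : ULift.{1} R).down * (b : ULift.{1} R).down) : ULift.{1} R)
  | _ :: β, a, b =>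
    letI : Mul (NS R β) := ⟨nsMul R β⟩
    ⟨(a : BStream _ (NS R β)).state × (b : BStream _ (NS R β)).state,
      (a : BStream _ (NS R β)).str.mul (b : BStream _ (NS R β)).str⟩

/-- Hereditarily simple nested streams: at the top level the stream is simple,
and all values at reachable states are hereditarily simple. -/
def HSimple (R : Type) : (α : List IdxTy) → NS R α → Prop
  | [], _ => True
  | _ :: β, a =>
    (a : BStream _ (NS R β)).str.IsSimple ∧
      ∀ r ∈ (a : BStream _ (NS R β)).str.reachSet,
        HSimple R β ((a : BStream _ (NS R β)).str.v r)

/-- Strict nested streams: hereditarily, the evaluation of the value is `0` at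
every reachable non-ready state. -/
def Strict (R : Type) [AddCommMonoid R] : (α : List IdxTy) → NS R α → Prop
  | [], _ => True
  | _ :: β, a =>
    letI := nfunAddCommMonoid R β
    (∀ r ∈ (a : BStream _ (NS R β)).str.reachSet,
        (a : BStream _ (NS R β)).str.ready r = false →
          nsEval R β ((a : BStream _ (NS R β)).str.v r) = 0) ∧
      ∀ r ∈ (a : BStream _ (NS R β)).str.reachSet,
        Strict R β ((a : BStream _ (NS R β)).str.v r)

namespace IStream

variable {σ σ₁ σ₂ : Type*} {I : Type*} {V : Type*}

/-- Two reachable ready states of a reduced stream with the same index coincide. -/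
theorem Reduced.eq_of_ready {s : IStream σ I V} (hs : s.Reduced) {r r' : σ}
    (hr : r ∈ s.reachSet) (hr' : r' ∈ s.reachSet) (h : s.ready r = true)
    (h' : s.ready r' = true) (hι : s.ι r = s.ι r') : r = r' := by
  obtain ⟨m, hm⟩ := id hr
  obtain ⟨n, hn⟩ := id hr'
  rcases le_total m n with hmn | hmn
  · refine hs r r' hr ⟨n - m, ?_⟩ h h' hι
    rw [hm, hn, ← Function.iterate_add_apply, Nat.sub_add_cancel hmn]
  · refine (hs r' r hr' ⟨m - n, ?_⟩ h' h hι.symm).symm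
    rw [hm, hn, ← Function.iterate_add_apply, Nat.sub_add_cancel hmn]

theorem eval_eq_of_unique {R : Type*} [AddCommMonoid R] (s : IStream σ I V) (f : V → R) {r : σ}
    (hr : r ∈ s.reachSet) (h : s.ready r = true)
    (huniq : ∀ r' ∈ s.reachSet, s.ready r' = true → s.ι r' = s.ι r → r' = r) :
    s.eval f (s.ι r) = f (s.v r) := by
  unfold eval
  rw [finsum_eq_single _ r]
  · simp [hr, h]
  · intro r' hne
    by_cases hr' : r' ∈ s.reachSet
    · by_cases hrd : s.ready r' = true
      · have : s.ι r ≠ s.ι r' := fun e => hne (huniq r' hr' hrd e.symm)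
        simp [hr', hrd, this]
      · simp [hrd]
    · simp [hr']

theorem eval_eq_zero {R : Type*} [AddCommMonoid R] (s : IStream σ I V) (f : V → R) {y : I}
    (h : ∀ r ∈ s.reachSet, s.ready r = true → s.ι r ≠ y) : s.eval f y = 0 := by
  unfold eval
  refine finsum_mem_eq_zero_of_forall_eq_zero fun r hr => ?_
  by_cases hrd : s.ready r = true
  · simp [hrd, (h r hr hrd).symm]
  · simp [hrd]

theorem iterate_mem_reachSet (s : IStream σ I V) (k : ℕ) : s.δ^[k] s.q ∈ s.reachSet := ⟨k, rfl⟩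

theorem δ_mem_reachSet {s : IStream σ I V} {r : σ} (hr : r ∈ s.reachSet) :
    s.δ r ∈ s.reachSet := by
  obtain ⟨k, rfl⟩ := hr
  exact ⟨k + 1, (Function.iterate_succ_apply' _ _ _).symm⟩

theorem Monotonic.monotone_iterate [Preorder I] {s : IStream σ I V} (hs : s.Monotonic) :
    Monotone fun k => s.ι (s.δ^[k] s.q) := by
  refine monotone_nat_of_le_succ fun k => ?_
  rw [Function.iterate_succ_apply']
  exact hs _ (s.iterate_mem_reachSet k)

variable [LinearOrder I] [Mul V] {a : IStream σ₁ I V} {b : IStream σ₂ I V}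

theorem mem_reachSet_of_mul {p : σ₁ × σ₂} (hp : p ∈ (a.mul b).reachSet) :
    p.1 ∈ a.reachSet ∧ p.2 ∈ b.reachSet := by
  obtain ⟨k, rfl⟩ := hp
  induction k with
  | zero => exact ⟨⟨0, rfl⟩, ⟨0, rfl⟩⟩
  | succ k ih =>
    rw [Function.iterate_succ_apply']
    generalize (a.mul b).δ^[k] (a.mul b).q = p at ih
    simp only [mul]
    split_ifs
    · exact ⟨δ_mem_reachSet ih.1, ih.2⟩
    · exact ⟨ih.1, δ_mem_reachSet ih.2⟩

/-- The product stream visits every pair of reachable states with equal indices whose first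
component is ready. -/
theorem mk_mem_reachSet_mul (ha : a.Monotonic) (hb : b.Monotonic) (hra : a.Reduced)
    {r : σ₁} {s : σ₂} (hr : r ∈ a.reachSet) (hs : s ∈ b.reachSet)
    (hrr : a.ready r = true) (hι : a.ι r = b.ι s) :
    (r, s) ∈ (a.mul b).reachSet := by
  classical
  obtain ⟨m, hm, hmin⟩ : ∃ m, r = a.δ^[m] a.q ∧ ∀ j < m, r ≠ a.δ^[j] a.q :=
    ⟨Nat.find hr, Nat.find_spec hr, fun _ hj => Nat.find_min hr hj⟩
  obtain ⟨n, hn⟩ := id hs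
  have key : ∀ k ≤ m + n, ∃ i j, i ≤ m ∧ j ≤ n ∧ i + j = k ∧
      (a.mul b).δ^[k] (a.mul b).q = (a.δ^[i] a.q, b.δ^[j] b.q) := by
    intro k
    induction k with
    | zero => exact fun _ => ⟨0, 0, by simp, by simp, rfl, rfl⟩
    | succ k ih =>
      intro hk
      obtain ⟨i, j, hi, hj, hij, he⟩ := ih (by omega)
      have hai : a.ι (a.δ^[i] a.q) ≤ a.ι r := hm ▸ ha.monotone_iterate hi
      have hbj : b.ι (b.δ^[j] b.q) ≤ b.ι s := hn ▸ hb.monotone_iterate hj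
      rw [Function.iterate_succ_apply', he]
      simp only [mul]
      split_ifs with hc
      · refine ⟨i + 1, j, ?_, hj, by omega, by rw [Function.iterate_succ_apply']⟩
        by_contra hlt
        obtain rfl : i = m := by omega
        rw [← hm] at hc
        rcases hc with hc | hc
        · exact absurd (hc.trans_le hbj) (by simp [hι])
        · simp [hrr] at hc
      · refine ⟨i, j + 1, hi, ?_, by omega, by rw [Function.iterate_succ_apply']⟩
        by_contra hlt
        obtain rfl : j = n := by omega
        rw [← hn] at hc
        push Not at hc
        have heq : a.ι (a.δ^[i] a.q) = b.ι s := le_antisymm (hι ▸ hai) hc.1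
        exact hmin i (by omega) (hra.eq_of_ready hr (a.iterate_mem_reachSet i) hrr
          (by simpa using hc.2 heq) (hι.trans heq.symm))
  obtain ⟨i, j, hi, hj, hij, he⟩ := key (m + n) le_rfl
  obtain rfl : i = m := by omega
  obtain rfl : j = n := by omega
  exact ⟨i + j, by rw [he, ← hm, ← hn]⟩

/-- Evaluation of a product stream, given a binary operation `op` on the target which the
evaluation of values respects at reachable states. -/
theorem eval_mul_apply {R : Type*} [AddCommMonoid R] (ha : a.Monotonic) (hb : b.Monotonic)
    (hra : a.Reduced) (hrb : b.Reduced) (f : V → R) (op : R → R → R)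
    (op_zero : ∀ x, op x 0 = 0) (zero_op : ∀ x, op 0 x = 0)
    (hf : ∀ r ∈ a.reachSet, ∀ s ∈ b.reachSet, f (a.v r * b.v s) = op (f (a.v r)) (f (b.v s)))
    (y : I) : (a.mul b).eval f y = op (a.eval f y) (b.eval f y) := by
  have ready_iff : ∀ p, (a.mul b).ready p = true ↔
      a.ready p.1 = true ∧ b.ready p.2 = true ∧ a.ι p.1 = b.ι p.2 := fun p => by
    simp [mul, and_assoc]
  by_cases hA : ∃ r ∈ a.reachSet, a.ready r = true ∧ a.ι r = y
  · by_cases hB : ∃ s ∈ b.reachSet, b.ready s = true ∧ b.ι s = y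
    · obtain ⟨r, hr, hrr, rfl⟩ := hA
      obtain ⟨s, hs, hrs, hι⟩ := hB
      have hιp : (a.mul b).ι (r, s) = a.ι r := by simp [mul, hι]
      rw [a.eval_eq_of_unique f hr hrr fun r' h h' e => hra.eq_of_ready h hr h' hrr e]
      conv_rhs => rw [← hι]
      rw [b.eval_eq_of_unique f hs hrs fun s' h h' e => hrb.eq_of_ready h hs h' hrs e, ← hιp,
        (a.mul b).eval_eq_of_unique f (mk_mem_reachSet_mul ha hb hra hr hs hrr hι.symm)
          ((ready_iff _).2 ⟨hrr, hrs, hι.symm⟩)]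
      · exact hf r hr s hs
      · rintro ⟨r', s'⟩ hp hrp e
        obtain ⟨h₁, h₂, h₃⟩ := (ready_iff _).1 hrp
        obtain ⟨hr', hs'⟩ := mem_reachSet_of_mul hp
        have e' : a.ι r' = a.ι r := by
          rw [hιp] at e
          simpa [mul, h₃] using e
        exact Prod.ext (hra.eq_of_ready hr' hr h₁ hrr e')
          (hrb.eq_of_ready hs' hs h₂ hrs (h₃.symm.trans (e'.trans hι.symm)))
    · push Not at hB
      rw [b.eval_eq_zero f hB, op_zero]
      refine eval_eq_zero _ f fun p hp hrp e => ?_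
      obtain ⟨-, h₂, h₃⟩ := (ready_iff _).1 hrp
      exact hB p.2 (mem_reachSet_of_mul hp).2 h₂ (by simpa [mul, h₃] using e)
  · push Not at hA
    rw [a.eval_eq_zero f hA, zero_op]
    refine eval_eq_zero _ f fun p hp hrp e => ?_
    obtain ⟨h₁, -, h₃⟩ := (ready_iff _).1 hrp
    exact hA p.1 (mem_reachSet_of_mul hp).1 h₁ (by simpa [mul, h₃] using e)

end IStream

theorem nfunMul_zero (R : Type) [CommSemiring R] (α : List IdxTy) (f : NFun R α) :
    letI := nfunAddCommMonoid R α
    nfunMul R α f 0 = 0 := by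
  induction α with
  | nil => exact mul_zero (M₀ := R) f
  | cons i β ih => exact funext fun x => ih (f x)

theorem zero_nfunMul (R : Type) [CommSemiring R] (α : List IdxTy) (f : NFun R α) :
    letI := nfunAddCommMonoid R α
    nfunMul R α 0 f = 0 := by
  induction α with
  | nil => exact zero_mul (M₀ := R) f
  | cons i β ih => exact funext fun x => ih (f x)

/-- evaluation of nested streams is multiplicative on
hereditarily simple, strict nested streams:
`eval_α (a·b) = eval_α a · eval_α b` (pointwise product of curried functions). -/
theorem nsEval_mul (R : Type) [CommSemiring R] (α : List IdxTy)
    (a b : NS R α) (ha : HSimple R α a) (hb : HSimple R α b)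
    (hsa : Strict R α a) (hsb : Strict R α b) :
    nsEval R α (nsMul R α a b) = nfunMul R α (nsEval R α a) (nsEval R α b) := by
  induction α with
  | nil => rfl
  | cons i β ih =>
    let := nfunAddCommMonoid R β
    let : Mul (NS R β) := ⟨nsMul R β⟩
    obtain ⟨⟨-, hma, hra⟩, hva⟩ := ha
    obtain ⟨⟨-, hmb, hrb⟩, hvb⟩ := hb
    exact funext fun y => IStream.eval_mul_apply hma hmb hra hrb (nsEval R β) (nfunMul R β)
      (nfunMul_zero R β) (zero_nfunMul R β)
      (fun r hr s hs => ih _ _ (hva r hr) (hvb s hs) (hsa.2 r hr) (hsb.2 s hs)) y
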